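/- Let G be an r-bounded κ-spread hypergraph on a finite set Y, let t = α|Y| be an integer with ακ ≥ 2r, and let W be a uniformly random t-element subset of Y. Then P(W contains no edge of G) ≤ 2·exp[−ακ/(2r)]. -/

import Mathlib

open Finset

/-- The probability that the `p`-random subset of `Y` equals `T`. -/
noncomputable def randomSubsetWeight {Y : Type*} [Fintype Y] (p : ℝ) (T : Finset Y) : ℝ :=
  p ^ #T * (1 - p) ^ (Fintype.card Y - #T)

section RandomSubset

variable {Y : Type*} [Fintype Y] {p : ℝ}

theorem randomSubsetWeight_nonneg (h0 : 0 ≤ p) (h1 : p ≤ 1) (T : Finset Y) :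
    0 ≤ randomSubsetWeight p T := by
  have := sub_nonneg.2 h1
  unfold randomSubsetWeight
  positivity

theorem sum_randomSubsetWeight : ∑ T : Finset Y, randomSubsetWeight p T = 1 := by
  simp [randomSubsetWeight, Fintype.sum_pow_mul_eq_add_pow]

variable [DecidableEq Y]

theorem sum_randomSubsetWeight_ite_mem (b : Y) (g : Finset Y → ℝ) :
    ∑ T, randomSubsetWeight p T * (if b ∈ T then g T else 0)
      = p * ∑ T, randomSubsetWeight p T * g (insert b T) := by
  have hb : b ∉ (univ.erase b : Finset Y) := by simp
  have hu : (univ : Finset (Finset Y)) = (insert b (univ.erase b)).powerset := by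
    rw [insert_erase (mem_univ b), powerset_univ]
  rw [hu, sum_powerset_insert hb, sum_powerset_insert hb, ← sum_add_distrib, ← sum_add_distrib,
    mul_sum]
  refine sum_congr rfl fun T hT => ?_
  have hbT : b ∉ T := fun h => hb (mem_powerset.1 hT h)
  have hcard : #T + 1 ≤ Fintype.card Y := by
    rw [← card_insert_of_notMem hbT]; exact card_le_univ _
  obtain ⟨d, hd⟩ := Nat.exists_eq_add_of_le hcard
  simp only [hbT, if_false, mem_insert_self, if_true, insert_idem, randomSubsetWeight,
    card_insert_of_notMem hbT]
  rw [show Fintype.card Y - #T = d + 1 by omega, show Fintype.card Y - (#T + 1) = d by omega]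
  ring

theorem sum_randomSubsetWeight_ite_subset (B : Finset Y) (g : Finset Y → ℝ) :
    ∑ T, randomSubsetWeight p T * (if B ⊆ T then g T else 0)
      = p ^ #B * ∑ T, randomSubsetWeight p T * g (T ∪ B) := by
  induction B using Finset.induction_on generalizing g with
  | empty => simp
  | insert b B hb ih =>
    have h := sum_randomSubsetWeight_ite_mem (p := p) b (fun T => if B ⊆ T then g T else 0)
    simp only [insert_subset_iff, ite_and]
    rw [h]
    simp only [subset_insert_iff_of_notMem hb]
    rw [ih (fun T => g (insert b T)), card_insert_of_notMem hb, pow_succ]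
    simp only [union_insert]
    ring

theorem sum_randomSubsetWeight_subset (B : Finset Y) :
    ∑ T, randomSubsetWeight p T * (if B ⊆ T then 1 else 0) = p ^ #B := by
  rw [sum_randomSubsetWeight_ite_subset B fun _ => 1]
  simp [sum_randomSubsetWeight]

/-- Harris' inequality for decreasing functions with values at most one. -/
theorem sum_randomSubsetWeight_mul_le (h0 : 0 ≤ p) (h1 : p ≤ 1) {f g : Finset Y → ℝ}
    (hf : Antitone f) (hg : Antitone g) (hf1 : f ≤ 1) (hg1 : g ≤ 1) :
    (∑ T, randomSubsetWeight p T * f T) * ∑ T, randomSubsetWeight p T * g T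
      ≤ ∑ T, randomSubsetWeight p T * (f T * g T) := by
  have h := fkg (μ := randomSubsetWeight p) (f := 1 - f) (g := 1 - g)
    (randomSubsetWeight_nonneg h0 h1) (sub_nonneg.2 hf1) (sub_nonneg.2 hg1)
    (fun a b hab => sub_le_sub_left (hf hab) _) (fun a b hab => sub_le_sub_left (hg hab) _)
    (fun a b => le_of_eq ?_)
  · simp only [Pi.sub_apply, Pi.one_apply, mul_sub, sub_mul, mul_one, one_mul, sum_sub_distrib,
      sum_randomSubsetWeight] at h
    linarith
  · have hc := card_union_add_card_inter a b
    have ha := card_le_univ a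
    have hb := card_le_univ b
    have hi := card_le_univ (a ∩ b)
    have hu := card_le_univ (a ∪ b)
    unfold randomSubsetWeight
    rw [inf_eq_inter, sup_eq_union, mul_mul_mul_comm, ← pow_add, ← pow_add,
      mul_mul_mul_comm, ← pow_add, ← pow_add]
    congr 2 <;> omega

end RandomSubset

section Janson

variable {Y ι : Type*} [DecidableEq Y] [Fintype ι]

/-- The number of edges `H i` with `i ∈ s` contained in `T`, each weighted by the inverse of the
probability that it is contained in a `p`-random set, normalised by the number of edges. -/
noncomputable def weightedEdgeCount (H : ι → Finset Y) (p : ℝ) (s : Finset ι) (T : Finset Y) : ℝ :=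
  ∑ i ∈ s, ((p ^ #(H i))⁻¹ / Fintype.card ι) * (if H i ⊆ T then 1 else 0)

variable {H : ι → Finset Y} {p : ℝ}

theorem weightedEdgeCount_nonneg (h0 : 0 ≤ p) (s : Finset ι) (T : Finset Y) :
    0 ≤ weightedEdgeCount H p s T := by
  unfold weightedEdgeCount
  positivity

theorem weightedEdgeCount_mono (h0 : 0 ≤ p) (s : Finset ι) :
    Monotone (weightedEdgeCount H p s) := by
  intro T T' h
  refine sum_le_sum fun i _ => mul_le_mul_of_nonneg_left ?_ (by positivity)
  split_ifs with h1 h2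
  · rfl
  · exact absurd (h1.trans h) h2
  · exact zero_le_one
  · rfl

theorem weightedEdgeCount_union_le (h0 : 0 ≤ p) (j : ι) (T : Finset Y) :
    weightedEdgeCount H p univ (T ∪ H j) ≤ weightedEdgeCount H p univ T
      + weightedEdgeCount H p {i | ¬ Disjoint (H i) (H j)} (T ∪ H j) := by
  unfold weightedEdgeCount
  rw [sum_filter, ← sum_add_distrib]
  refine sum_le_sum fun i _ => ?_
  have hw : 0 ≤ (p ^ #(H i))⁻¹ / (Fintype.card ι : ℝ) := by positivity
  by_cases hd : Disjoint (H i) (H j)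
  · have : H i ⊆ T ∪ H j ↔ H i ⊆ T :=
      ⟨fun h => hd.left_le_of_le_sup_right h, fun h => h.trans subset_union_left⟩
    simp [hd, this]
  · rw [if_pos hd]
    have : 0 ≤ (p ^ #(H i))⁻¹ / (Fintype.card ι : ℝ) * (if H i ⊆ T then (1 : ℝ) else 0) := by
      positivity
    linarith

variable [Fintype Y]

theorem sum_randomSubsetWeight_mul_weightedEdgeCount (h0 : 0 < p) (g : Finset Y → ℝ) :
    ∑ T, randomSubsetWeight p T * (weightedEdgeCount H p univ T * g T)
      = (∑ j, ∑ T, randomSubsetWeight p T * g (T ∪ H j)) / Fintype.card ι := by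
  simp only [weightedEdgeCount, sum_mul, mul_sum]
  rw [sum_comm, sum_div]
  refine sum_congr rfl fun i _ => ?_
  have h := sum_randomSubsetWeight_ite_subset (p := p) (H i) g
  have hp : p ^ #(H i) ≠ 0 := by positivity
  calc _ = ((p ^ #(H i))⁻¹ / Fintype.card ι) *
        ∑ T, randomSubsetWeight p T * (if H i ⊆ T then g T else 0) := by
        rw [mul_sum]
        refine sum_congr rfl fun T _ => ?_
        split_ifs <;> ring
    _ = _ := by
        rw [h]
        field_simp

theorem sum_randomSubsetWeight_mul_weightedEdgeCount_union (h0 : 0 < p) (s : Finset ι) (j : ι) :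
    ∑ T, randomSubsetWeight p T * weightedEdgeCount H p s (T ∪ H j)
      = (∑ i ∈ s, (p ^ #(H i ∩ H j))⁻¹) / Fintype.card ι := by
  simp only [weightedEdgeCount, mul_sum]
  rw [sum_comm, sum_div]
  refine sum_congr rfl fun i _ => ?_
  have h := sum_randomSubsetWeight_subset (p := p) (H i \ H j)
  calc _ = ((p ^ #(H i))⁻¹ / Fintype.card ι) *
        ∑ T, randomSubsetWeight p T * (if H i \ H j ⊆ T then 1 else 0) := by
        rw [mul_sum]
        refine sum_congr rfl fun T _ => ?_
        have hiff : H i \ H j ⊆ T ↔ H i ⊆ T ∪ H j := sdiff_le_iff'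
        simp only [hiff]
        ring
    _ = _ := by
        rw [h, ← card_sdiff_add_card_inter (H i) (H j), pow_add]
        have : p ^ #(H i \ H j) ≠ 0 := by positivity
        have : p ^ #(H i ∩ H j) ≠ 0 := by positivity
        field_simp

variable [Nonempty ι]

theorem laplace_mul_exp_le (h0 : 0 < p) (h1 : p ≤ 1) {D s : ℝ} (hs : 0 ≤ s)
    (hD : ∀ j, ∑ i with ¬ Disjoint (H i) (H j), (p ^ #(H i ∩ H j))⁻¹ ≤ D * Fintype.card ι) :
    (∑ T, randomSubsetWeight p T * Real.exp (-s * weightedEdgeCount H p univ T))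
        * Real.exp (-s * D)
      ≤ ∑ T, randomSubsetWeight p T * (weightedEdgeCount H p univ T
          * Real.exp (-s * weightedEdgeCount H p univ T)) := by
  have hN : (0 : ℝ) < Fintype.card ι := by exact_mod_cast Fintype.card_pos
  rw [sum_randomSubsetWeight_mul_weightedEdgeCount h0, le_div_iff₀ hN]
  set ψ := ∑ T, randomSubsetWeight p T * Real.exp (-s * weightedEdgeCount H p univ T)
  have hψ : 0 ≤ ψ := sum_nonneg fun T _ =>
    mul_nonneg (randomSubsetWeight_nonneg h0.le h1 T) (Real.exp_pos _).le
  have anti : ∀ f : Finset Y → ℝ, Monotone f → Antitone fun T => Real.exp (-s * f T) := by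
    intro f hf T T' h
    have := mul_le_mul_of_nonneg_left (hf h) hs
    exact Real.exp_le_exp.2 (by linarith)
  have le_one : ∀ f : Finset Y → ℝ, 0 ≤ f → (fun T => Real.exp (-s * f T)) ≤ 1 := by
    intro f hf T
    have := mul_nonneg hs (hf T)
    exact Real.exp_le_one_iff.2 (by linarith)
  rw [mul_comm, ← nsmul_eq_mul, ← card_univ]
  refine card_nsmul_le_sum _ _ _ fun j _ => ?_
  set Z : Finset Y → ℝ :=
    fun T => weightedEdgeCount H p {i | ¬ Disjoint (H i) (H j)} (T ∪ H j) with hZ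
  have hZmean : ∑ T, randomSubsetWeight p T * Z T ≤ D := by
    rw [hZ, sum_randomSubsetWeight_mul_weightedEdgeCount_union h0, div_le_iff₀ hN]
    exact hD j
  have hjensen : Real.exp (-s * D) ≤ ∑ T, randomSubsetWeight p T * Real.exp (-s * Z T) := by
    calc Real.exp (-s * D)
        ≤ Real.exp (-s * D) * (1 + s * (D - ∑ T, randomSubsetWeight p T * Z T)) := by
          have := mul_nonneg hs (sub_nonneg.2 hZmean)
          exact le_mul_of_one_le_right (Real.exp_pos _).le (by linarith)
      _ = ∑ T, randomSubsetWeight p T * (Real.exp (-s * D) * (s * D - s * Z T + 1)) := by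
          have h : ∀ T, randomSubsetWeight p T * (Real.exp (-s * D) * (s * D - s * Z T + 1))
            = Real.exp (-s * D) * (1 + s * D) * randomSubsetWeight p T
              - Real.exp (-s * D) * s * (randomSubsetWeight p T * Z T) := fun T => by ring
          simp only [h, sum_sub_distrib, ← mul_sum, sum_randomSubsetWeight]
          ring
      _ ≤ _ := by
          refine sum_le_sum fun T _ =>
            mul_le_mul_of_nonneg_left ?_ (randomSubsetWeight_nonneg h0.le h1 T)
          rw [show -s * Z T = -s * D + (s * D - s * Z T) by ring, Real.exp_add]
          exact mul_le_mul_of_nonneg_left (Real.add_one_le_exp _) (Real.exp_pos _).le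
  calc ψ * Real.exp (-s * D)
      ≤ ψ * ∑ T, randomSubsetWeight p T * Real.exp (-s * Z T) := by gcongr
    _ ≤ ∑ T, randomSubsetWeight p T *
          (Real.exp (-s * weightedEdgeCount H p univ T) * Real.exp (-s * Z T)) :=
        sum_randomSubsetWeight_mul_le h0.le h1
          (anti _ (weightedEdgeCount_mono h0.le _))
          (anti _ fun T T' h => weightedEdgeCount_mono h0.le _ (union_subset_union_left h))
          (le_one _ (weightedEdgeCount_nonneg h0.le _))
          (le_one _ fun T => weightedEdgeCount_nonneg h0.le _ _)
    _ ≤ _ := by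
        refine sum_le_sum fun T _ =>
          mul_le_mul_of_nonneg_left ?_ (randomSubsetWeight_nonneg h0.le h1 T)
        rw [← Real.exp_add, Real.exp_le_exp]
        have := mul_le_mul_of_nonneg_left (weightedEdgeCount_union_le (H := H) h0.le j T) hs
        linarith

/-- Janson's inequality for the probability that a random set contains no edge, where edges are
weighted by the inverse of their probability of being contained in the random set. -/
theorem janson_inequality (h0 : 0 < p) (h1 : p ≤ 1) {D : ℝ} (hD0 : 0 < D)
    (hD : ∀ j, ∑ i with ¬ Disjoint (H i) (H j), (p ^ #(H i ∩ H j))⁻¹ ≤ D * Fintype.card ι) :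
    ∑ T with ∀ j, ¬ H j ⊆ T, randomSubsetWeight p T ≤ Real.exp (-D⁻¹) := by
  set ψ : ℝ → ℝ := fun s =>
    ∑ T, randomSubsetWeight p T * Real.exp (-s * weightedEdgeCount H p univ T) with hψ
  have hψd : ∀ s, HasDerivAt ψ (-∑ T, randomSubsetWeight p T * (weightedEdgeCount H p univ T
          * Real.exp (-s * weightedEdgeCount H p univ T))) s := by
    intro s
    rw [← sum_neg_distrib]
    refine HasDerivAt.fun_sum fun T _ => ?_
    have := ((((hasDerivAt_id s).neg.mul_const (weightedEdgeCount H p univ T)).exp).const_mul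
      (randomSubsetWeight p T))
    convert! this using 1
    simp only [Pi.neg_apply, id_eq]
    ring
  have hed : ∀ s, HasDerivAt (fun s => Real.exp (-(D⁻¹ * Real.exp (-s * D))))
      (Real.exp (-(D⁻¹ * Real.exp (-s * D))) * Real.exp (-s * D)) s := by
    intro s
    have := ((((hasDerivAt_id s).neg.mul_const D).exp).const_mul D⁻¹).neg.exp
    convert! this using 1
    simp
    field_simp
  have hanti : AntitoneOn (fun s => ψ s * Real.exp (-(D⁻¹ * Real.exp (-s * D)))) (Set.Ici 0) := by
    refine antitoneOn_of_hasDerivWithinAt_nonpos (convex_Ici 0)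
      (fun s _ => ((hψd s).mul (hed s)).continuousAt.continuousWithinAt)
      (fun s _ => ((hψd s).mul (hed s)).hasDerivWithinAt) fun s hs => ?_
    rw [interior_Ici] at hs
    have h := mul_le_mul_of_nonneg_right (laplace_mul_exp_le (H := H) h0 h1 (le_of_lt hs) hD)
      (Real.exp_pos (-(D⁻¹ * Real.exp (-s * D)))).le
    simp only [hψ]
    linarith
  have hP : ∀ s, ∑ T with ∀ j, ¬ H j ⊆ T, randomSubsetWeight p T ≤ ψ s := by
    intro s
    rw [sum_filter]
    refine sum_le_sum fun T _ => ?_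
    split_ifs with h
    · simp [weightedEdgeCount, h]
    · exact mul_nonneg (randomSubsetWeight_nonneg h0.le h1 T) (Real.exp_pos _).le
  have hψ0 : ψ 0 = 1 := by simp [hψ, sum_randomSubsetWeight]
  have hbound : ∀ s, 0 ≤ s → (∑ T with ∀ j, ¬ H j ⊆ T, randomSubsetWeight p T)
      * Real.exp (-(D⁻¹ * Real.exp (-s * D))) ≤ Real.exp (-D⁻¹) := by
    intro s hs
    have h := hanti (Set.self_mem_Ici) hs hs
    simp only [hψ0, neg_zero, zero_mul, Real.exp_zero, mul_one, one_mul] at h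
    exact (mul_le_mul_of_nonneg_right (hP s) (Real.exp_pos _).le).trans h
  have hlim : Filter.Tendsto (fun s : ℝ => Real.exp (-(D⁻¹ * Real.exp (-s * D))))
      Filter.atTop (nhds 1) := by
    have h1 : Filter.Tendsto (fun s : ℝ => Real.exp (-s * D)) Filter.atTop (nhds 0) := by
      refine Real.tendsto_exp_atBot.comp ?_
      exact Filter.tendsto_neg_atTop_atBot.atBot_mul_const hD0
    have h2 := (Real.continuous_exp.tendsto _).comp ((h1.const_mul D⁻¹).neg)
    simpa using! h2
  have := hlim.const_mul (∑ T with ∀ j, ¬ H j ⊆ T, randomSubsetWeight p T)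
  rw [mul_one] at this
  exact le_of_tendsto this (Filter.eventually_atTop.2 ⟨0, hbound⟩)

end Janson

theorem choose_mul_pow_le_choose_mul_pow {t m : ℕ} (hmt : m ≤ t) {i : ℕ} (hi : i < m) :
    (t + m).choose (t + 1 + i) * t ^ (2 * i + 1) ≤ (t + m).choose (t - i) * m ^ (2 * i + 1) := by
  induction i with
  | zero =>
    have h := Nat.choose_succ_right_eq (t + m) t
    rw [Nat.add_sub_cancel_left] at h
    simp only [mul_zero, zero_add, pow_one, add_zero, Nat.sub_zero]
    rw [← h]
    gcongr
    omega
  | succ i ih =>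
    have ih := ih (by omega)
    obtain ⟨d, rfl⟩ : ∃ d, m = i + 2 + d := ⟨m - (i + 2), by omega⟩
    obtain ⟨e, rfl⟩ : ∃ e, t = i + 2 + d + e := ⟨t - (i + 2 + d), by omega⟩
    have h1 := Nat.choose_succ_right_eq (i + 2 + d + e + (i + 2 + d)) (i + 2 + d + e + 1 + i)
    have h2 := Nat.choose_succ_right_eq (i + 2 + d + e + (i + 2 + d)) (d + e + 1)
    rw [show i + 2 + d + e + (i + 2 + d) - (i + 2 + d + e + 1 + i) = d + 1 by omega] at h1
    rw [show i + 2 + d + e + (i + 2 + d) - (d + e + 1) = 2 * i + 3 + d by omega] at h2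
    rw [show i + 2 + d + e - i = d + e + 1 + 1 by omega] at ih
    rw [show i + 2 + d + e - (i + 1) = d + e + 1 by omega, ← add_assoc (i + 2 + d + e + 1) i 1]
    set c1 := (i + 2 + d + e + (i + 2 + d)).choose (i + 2 + d + e + 1 + i + 1)
    set c2 := (i + 2 + d + e + (i + 2 + d)).choose (i + 2 + d + e + 1 + i)
    set c3 := (i + 2 + d + e + (i + 2 + d)).choose (d + e + 1 + 1)
    set c4 := (i + 2 + d + e + (i + 2 + d)).choose (d + e + 1)
    set t := i + 2 + d + e with ht
    set m := i + 2 + d with hm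
    have hpos : 0 < (t + 1 + i + 1) * (d + e + 1 + 1) := by positivity
    refine le_of_mul_le_mul_right ?_ hpos
    have key : (d + 1) * (2 * i + 3 + d) * t ^ 2 ≤ (t + 1 + i + 1) * (d + e + 1 + 1) * m ^ 2 := by
      zify [ht, hm]
      have h3 : ((d : ℤ) + 1) * (2 * i + 3 + d) = (i + 2 + d) ^ 2 - (i + 1) ^ 2 := by ring
      have h4 : ((i : ℤ) + 2 + d + e + 1 + i + 1) * (d + e + 1 + 1)
        = (i + 2 + d + e + 1) ^ 2 - (i + 1) ^ 2 := by ring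
      rw [h3, h4]
      have h5 := mul_le_mul_of_nonneg_left (pow_le_pow_left₀ (by positivity)
        (by lia : (i : ℤ) + 2 + d ≤ i + 2 + d + e) 2) (by positivity : 0 ≤ ((i : ℤ) + 1) ^ 2)
      have h6 := mul_le_mul_of_nonneg_right (pow_le_pow_left₀ (by positivity)
        (by lia : (i : ℤ) + 2 + d + e ≤ i + 2 + d + e + 1) 2)
        (by positivity : 0 ≤ ((i : ℤ) + 2 + d) ^ 2)
      linarith
    calc c1 * t ^ (2 * (i + 1) + 1) * ((t + 1 + i + 1) * (d + e + 1 + 1))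
        = (c1 * (t + 1 + i + 1)) * t ^ (2 * i + 1) * t ^ 2 * (d + e + 1 + 1) := by ring
      _ = (c2 * t ^ (2 * i + 1)) * ((d + 1) * t ^ 2 * (d + e + 1 + 1)) := by rw [h1]; ring
      _ ≤ (c3 * m ^ (2 * i + 1)) * ((d + 1) * t ^ 2 * (d + e + 1 + 1)) := by gcongr
      _ = (c3 * (d + e + 1 + 1)) * m ^ (2 * i + 1) * ((d + 1) * t ^ 2) := by ring
      _ = c4 * m ^ (2 * i + 1) * ((d + 1) * (2 * i + 3 + d) * t ^ 2) := by rw [h2]; ring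
      _ ≤ c4 * m ^ (2 * i + 1) * ((t + 1 + i + 1) * (d + e + 1 + 1) * m ^ 2) := by gcongr
      _ = _ := by ring

theorem bernsteinPolynomial_eval_nonneg {n s : ℕ} {p : ℝ} (h0 : 0 ≤ p) (h1 : p ≤ 1) :
    0 ≤ (bernsteinPolynomial ℝ n s).eval p := by
  have := sub_nonneg.2 h1
  simp only [bernsteinPolynomial, Polynomial.eval_mul, Polynomial.eval_natCast,
    Polynomial.eval_pow, Polynomial.eval_X, Polynomial.eval_sub, Polynomial.eval_one]
  positivity

theorem sum_bernsteinPolynomial_eval (n : ℕ) (p : ℝ) :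
    ∑ s ∈ range (n + 1), (bernsteinPolynomial ℝ n s).eval p = 1 := by
  rw [← Polynomial.eval_finsetSum, bernsteinPolynomial.sum, Polynomial.eval_one]

theorem half_le_sum_bernsteinPolynomial_of_ge {t m : ℕ} {p : ℝ} (h0 : 0 ≤ p) (h1 : p ≤ 1)
    (ht : (t : ℝ) = p * (t + m)) (hmt : m ≤ t) :
    1 / 2 ≤ ∑ s ∈ range (t + 1), (bernsteinPolynomial ℝ (t + m) s).eval p := by
  have hq : 0 ≤ 1 - p := sub_nonneg.2 h1
  have htot := sum_bernsteinPolynomial_eval (t + m) p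
  rw [show t + m + 1 = t + 1 + m by ring, sum_range_add] at htot
  have hle : ∑ i ∈ range m, (bernsteinPolynomial ℝ (t + m) (t + 1 + i)).eval p
      ≤ ∑ s ∈ range (t + 1), (bernsteinPolynomial ℝ (t + m) s).eval p := by
    rw [← sum_range_reflect (fun s => (bernsteinPolynomial ℝ (t + m) s).eval p)]
    refine (sum_le_sum fun i hi => ?_).trans (sum_le_sum_of_subset_of_nonneg
      (range_subset_range.2 (by omega : m ≤ t + 1))
      fun i _ _ => bernsteinPolynomial_eval_nonneg h0 h1)
    have hi := mem_range.1 hi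
    have hn : 0 < (t : ℝ) + m := by
      have : (0 : ℝ) < m := by exact_mod_cast (by omega : 0 < m)
      positivity
    have hm : (m : ℝ) = (1 - p) * (t + m) := by linarith
    have h : ((t + m).choose (t + 1 + i) : ℝ) * (t : ℝ) ^ (2 * i + 1)
        ≤ (t + m).choose (t - i) * (m : ℝ) ^ (2 * i + 1) := by
      exact_mod_cast choose_mul_pow_le_choose_mul_pow hmt hi
    generalize hN : (t : ℝ) + m = N at *
    rw [ht, hm, mul_pow, mul_pow, ← mul_assoc, ← mul_assoc] at h
    have h := le_of_mul_le_mul_right h (by positivity)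
    simp only [bernsteinPolynomial, Polynomial.eval_mul, Polynomial.eval_natCast,
      Polynomial.eval_pow, Polynomial.eval_X, Polynomial.eval_sub, Polynomial.eval_one]
    rw [show t + 1 - 1 - i = t - i by omega, show t + 1 + i = (2 * i + 1) + (t - i) by omega,
      show t + m - (t - i) = (2 * i + 1) + (m - 1 - i) by omega,
      show t + m - (2 * i + 1 + (t - i)) = m - 1 - i by omega, pow_add, pow_add (1 - p)]
    rw [show 2 * i + 1 + (t - i) = t + 1 + i by omega]
    have := mul_le_mul_of_nonneg_right h
      (by positivity : 0 ≤ p ^ (t - i) * (1 - p) ^ (m - 1 - i))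
    calc _ = _ := by ring
      _ ≤ _ := this
      _ = _ := by ring
  linarith

theorem mul_log_sub_log_le {a b : ℝ} (hb : 0 ≤ b) (hba : b ≤ a) (ha : a < 1) :
    a * (Real.log (1 + b) - Real.log (1 - b)) ≤ b * (Real.log (1 + a) - Real.log (1 - a)) := by
  have ha0 := hb.trans hba
  refine hasSum_le (fun k => ?_)
    ((Real.hasSum_log_sub_log_of_abs_lt_one (x := b)
      (by rw [abs_of_nonneg hb]; linarith)).mul_left a)
    ((Real.hasSum_log_sub_log_of_abs_lt_one (x := a) (by rwa [abs_of_nonneg ha0])).mul_left b)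
  have : b ^ (2 * k) ≤ a ^ (2 * k) := by gcongr
  calc _ = 2 * (1 / (2 * (k : ℝ) + 1)) * (a * b) * b ^ (2 * k) := by ring
    _ ≤ 2 * (1 / (2 * (k : ℝ) + 1)) * (a * b) * a ^ (2 * k) := by gcongr
    _ = _ := by ring

theorem mul_log_add_sub_log_sub_le {p q x : ℝ} (hp : 0 < p) (hpq : p ≤ q) (hx : 0 < x)
    (hxp : x < p) :
    q * (Real.log (q + x) - Real.log (q - x)) ≤ p * (Real.log (p + x) - Real.log (p - x)) := by
  have hq := hp.trans_le hpq
  have aux : ∀ r : ℝ, 0 < r → x < r → Real.log (r + x) - Real.log (r - x)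
      = Real.log (1 + x / r) - Real.log (1 - x / r) := by
    intro r hr hxr
    have h1 : 0 < 1 - x / r := by rw [sub_pos, div_lt_one hr]; exact hxr
    have h2 : 0 < 1 + x / r := by positivity
    rw [show r + x = r * (1 + x / r) by field_simp, show r - x = r * (1 - x / r) by field_simp,
      Real.log_mul hr.ne' h2.ne', Real.log_mul hr.ne' h1.ne']
    ring
  rw [aux p hp hxp, aux q hq (hxp.trans_le hpq)]
  have h := mul_log_sub_log_le (a := x / p) (b := x / q) (by positivity) (by gcongr)
    ((div_lt_one hp).2 hxp)
  have h := mul_le_mul_of_nonneg_left h (by positivity : 0 ≤ p * q / x)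
  calc _ = _ := by field_simp
    _ ≤ _ := h
    _ = _ := by field_simp

theorem pow_mul_pow_reflect_le {t k : ℕ} {p x : ℝ} (hp : 0 < p) (hp2 : p ≤ 1 / 2)
    (ht : (t : ℝ) = p * (t + (k + 1))) (hx : 0 < x) (hxp : x < p) :
    (p - x) ^ t * (1 - (p - x)) ^ k ≤ (p + x) ^ t * (1 - (p + x)) ^ k := by
  have h1 : 0 < p - x := by linarith
  have h2 : 0 < 1 - (p - x) := by linarith
  have h3 : 0 < p + x := by linarith
  have h4 : 0 < 1 - (p + x) := by linarith
  rw [← Real.log_le_log_iff (by positivity) (by positivity),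
    Real.log_mul (by positivity) (by positivity), Real.log_mul (by positivity) (by positivity)]
  simp only [Real.log_pow]
  have h := mul_log_add_sub_log_sub_le hp (by linarith : p ≤ 1 - p) hx hxp
  have hk : (k : ℝ) + 1 = (1 - p) * (t + (k + 1)) := by linarith
  have hmono : Real.log (1 - p - x) ≤ Real.log (1 - p + x) :=
    Real.log_le_log (by linarith) (by linarith)
  have hn : 0 ≤ (t : ℝ) + (k + 1) := by positivity
  rw [show 1 - (p - x) = 1 - p + x by ring, show 1 - (p + x) = 1 - p - x by ring]
  generalize (t : ℝ) + (k + 1) = N at *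
  have h5 := mul_le_mul_of_nonneg_left h hn
  have h6 : ((k : ℝ) + 1) * (Real.log (1 - p + x) - Real.log (1 - p - x))
      ≤ t * (Real.log (p + x) - Real.log (p - x)) := by
    rw [hk, ht]; linarith
  linarith

theorem derivative_sum_bernsteinPolynomial (n t : ℕ) :
    Polynomial.derivative (∑ s ∈ range (t + 1), bernsteinPolynomial ℝ n s)
      = -(n : Polynomial ℝ) * bernsteinPolynomial ℝ (n - 1) t := by
  induction t with
  | zero => simp [bernsteinPolynomial.derivative_zero]
  | succ t ih =>
    rw [sum_range_succ, Polynomial.derivative_add, ih, bernsteinPolynomial.derivative_succ]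
    ring

theorem half_le_sum_bernsteinPolynomial_of_le {t k : ℕ} {p : ℝ} (hp : 0 < p) (hp2 : p ≤ 1 / 2)
    (ht : (t : ℝ) = p * (t + (k + 1))) :
    1 / 2 ≤ ∑ s ∈ range (t + 1), (bernsteinPolynomial ℝ (t + (k + 1)) s).eval p := by
  rw [← Polynomial.eval_finsetSum]
  have hder := derivative_sum_bernsteinPolynomial (t + (k + 1)) t
  set F := ∑ s ∈ range (t + 1), bernsteinPolynomial ℝ (t + (k + 1)) s with hF
  have hd : ∀ x, HasDerivAt (fun x => F.eval (p - x) + F.eval (p + x))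
      (-(F.derivative.eval (p - x)) + F.derivative.eval (p + x)) x := by
    intro x
    have h1 := (F.hasDerivAt (p - x)).comp x ((hasDerivAt_id x).const_sub p)
    have h2 := (F.hasDerivAt (p + x)).comp x ((hasDerivAt_id x).const_add p)
    simpa using! h1.add h2
  have hanti : AntitoneOn (fun x => F.eval (p - x) + F.eval (p + x)) (Set.Icc 0 p) := by
    refine antitoneOn_of_hasDerivWithinAt_nonpos (convex_Icc 0 p)
      (fun x _ => (hd x).continuousAt.continuousWithinAt)
      (fun x _ => (hd x).hasDerivWithinAt) fun x hx => ?_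
    rw [interior_Icc] at hx
    rw [hder]
    have h := pow_mul_pow_reflect_le hp hp2 ht hx.1 hx.2
    simp only [bernsteinPolynomial, Polynomial.eval_mul, Polynomial.eval_natCast,
      Polynomial.eval_pow, Polynomial.eval_X, Polynomial.eval_sub, Polynomial.eval_one,
      Polynomial.eval_neg]
    rw [show t + (k + 1) - 1 - t = k by omega]
    have := mul_le_mul_of_nonneg_left h (by positivity :
      (0 : ℝ) ≤ ((t + (k + 1) : ℕ) : ℝ) * ((t + (k + 1) - 1).choose t))
    linarith
  have h := hanti ⟨le_rfl, hp.le⟩ ⟨hp.le, le_rfl⟩ hp.le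
  simp only [sub_self, sub_zero, add_zero] at h
  have h0 : F.eval 0 = 1 := by
    simp [hF, Polynomial.eval_finsetSum, bernsteinPolynomial.eval_at_0]
  have h2 : 0 ≤ F.eval (p + p) := by
    rw [hF, Polynomial.eval_finsetSum]
    exact sum_nonneg fun s _ => bernsteinPolynomial_eval_nonneg (by linarith) (by linarith)
  linarith

/-- If the mean `t` of a binomial distribution is an integer, then it is a median. -/
theorem half_le_sum_bernsteinPolynomial {t n : ℕ} (htn : t ≤ n) {p : ℝ} (hp : 0 < p) (hp1 : p ≤ 1)
    (ht : (t : ℝ) = p * n) :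
    1 / 2 ≤ ∑ s ∈ range (t + 1), (bernsteinPolynomial ℝ n s).eval p := by
  obtain ⟨m, rfl⟩ := Nat.exists_eq_add_of_le htn
  push_cast at ht
  rcases le_total m t with hmt | hmt
  · exact half_le_sum_bernsteinPolynomial_of_ge hp.le hp1 ht hmt
  · rcases m with _ | k
    · rw [add_zero, sum_bernsteinPolynomial_eval]; norm_num
    · push_cast at ht
      refine half_le_sum_bernsteinPolynomial_of_le hp ?_ ht
      have : (t : ℝ) ≤ k + 1 := by exact_mod_cast hmt
      by_contra! hlt
      have h0 : 0 < (t : ℝ) + (k + 1) := by positivity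
      nlinarith [mul_lt_mul_of_pos_right hlt h0]

section LowerSet

variable {Y : Type*} [Fintype Y] [DecidableEq Y] {𝒜 : Finset (Finset Y)}

theorem card_slice_div_choose_anti (h𝒜 : IsLowerSet (𝒜 : Set (Finset Y))) {s t : ℕ} (hst : s ≤ t) :
    (#(𝒜.slice t) : ℝ) / (Fintype.card Y).choose t
      ≤ #(𝒜.slice s) / (Fintype.card Y).choose s := by
  induction t, hst using Nat.le_induction with
  | base => rfl
  | succ t _ ih =>
    refine le_trans ?_ ih
    refine (local_lubell_yamamoto_meshalkin_inequality_div t.succ_ne_zero sized_slice).trans ?_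
    rw [Nat.succ_sub_one]
    gcongr
    intro S hS
    obtain ⟨T, hT, a, ha, rfl⟩ := mem_shadow_iff.1 hS
    rw [mem_slice] at hT ⊢
    exact ⟨h𝒜 (erase_subset a T) hT.1, by rw [card_erase_of_mem ha, hT.2]; rfl⟩

/-- The density of a lower set among the `t`-element sets is at most twice its probability for a
random set of integer mean size `t`. -/
theorem card_slice_div_choose_le (h𝒜 : IsLowerSet (𝒜 : Set (Finset Y))) {p : ℝ} (h0 : 0 < p)
    (h1 : p ≤ 1) {t : ℕ} (ht : (t : ℝ) = p * Fintype.card Y) :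
    (#(𝒜.slice t) : ℝ) / (Fintype.card Y).choose t ≤ 2 * ∑ T ∈ 𝒜, randomSubsetWeight p T := by
  have htn : t ≤ Fintype.card Y := by
    have : (t : ℝ) ≤ Fintype.card Y := ht ▸ mul_le_of_le_one_left (by positivity) h1
    exact_mod_cast this
  set d := (#(𝒜.slice t) : ℝ) / (Fintype.card Y).choose t
  have hd : 0 ≤ d := by positivity
  have hmed := half_le_sum_bernsteinPolynomial htn h0 h1 ht
  have hfib : ∑ s ∈ range (t + 1), ∑ T ∈ 𝒜 with #T = s, randomSubsetWeight p T
      ≤ ∑ T ∈ 𝒜, randomSubsetWeight p T :=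
    sum_fiberwise_le_sum_of_sum_fiber_nonneg fun s _ =>
      sum_nonneg fun T _ => randomSubsetWeight_nonneg h0.le h1 T
  have hle : ∑ s ∈ range (t + 1), d * (bernsteinPolynomial ℝ (Fintype.card Y) s).eval p
      ≤ ∑ s ∈ range (t + 1), ∑ T ∈ 𝒜 with #T = s, randomSubsetWeight p T := by
    refine sum_le_sum fun s hs => ?_
    have hst : s ≤ t := Nat.lt_succ_iff.1 (mem_range.1 hs)
    have hc : (0 : ℝ) < (Fintype.card Y).choose s := by
      exact_mod_cast Nat.choose_pos (hst.trans htn)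
    have hq : 0 ≤ 1 - p := sub_nonneg.2 h1
    have h := (le_div_iff₀ hc).1 (card_slice_div_choose_anti h𝒜 hst)
    have heq : ∑ T ∈ 𝒜 with #T = s, randomSubsetWeight p T
        = #(𝒜.slice s) * (p ^ s * (1 - p) ^ (Fintype.card Y - s)) := by
      rw [← nsmul_eq_mul]
      refine sum_eq_card_nsmul fun T hT => ?_
      rw [randomSubsetWeight, (mem_filter.1 hT).2]
    rw [heq]
    simp only [bernsteinPolynomial, Polynomial.eval_mul, Polynomial.eval_natCast,
      Polynomial.eval_pow, Polynomial.eval_X, Polynomial.eval_sub, Polynomial.eval_one]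
    calc _ = d * (Fintype.card Y).choose s * (p ^ s * (1 - p) ^ (Fintype.card Y - s)) := by ring
      _ ≤ _ := by gcongr
  rw [← mul_sum] at hle
  have := mul_le_mul_of_nonneg_left hmed hd
  linarith

end LowerSet

theorem sum_inv_pow_card_inter_le {Y ι : Type*} [DecidableEq Y] [Fintype ι] {H : ι → Finset Y}
    {κ p : ℝ} (hp : 0 < p)
    (hspread : ∀ S : Finset Y, (#{j | S ⊆ H j} : ℝ) ≤ κ⁻¹ ^ #S * Fintype.card ι) (j : ι) :
    ∑ i with ¬ Disjoint (H i) (H j), (p ^ #(H i ∩ H j))⁻¹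
      ≤ (((p * κ)⁻¹ + 1) ^ #(H j) - 1) * Fintype.card ι := by
  have hmaps : ∀ i ∈ ({i | ¬ Disjoint (H i) (H j)} : Finset ι),
      H i ∩ H j ∈ (H j).powerset.erase ∅ := by
    intro i hi
    rw [mem_erase, mem_powerset]
    exact ⟨fun h => (mem_filter.1 hi).2 (disjoint_iff_inter_eq_empty.2 h), inter_subset_right⟩
  rw [← sum_fiberwise_of_maps_to hmaps]
  calc _ ≤ ∑ S ∈ (H j).powerset.erase ∅, ((p * κ)⁻¹ ^ #S * 1 ^ (#(H j) - #S)) * Fintype.card ι := by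
        refine sum_le_sum fun S _ => ?_
        rw [sum_congr rfl fun i hi => by rw [(mem_filter.1 hi).2], sum_const, nsmul_eq_mul]
        have hcard : (#{i ∈ ({i | ¬ Disjoint (H i) (H j)} : Finset ι) | H i ∩ H j = S} : ℝ)
            ≤ #{i | S ⊆ H i} := by
          gcongr
          intro i hi
          rw [mem_filter] at hi ⊢
          exact ⟨mem_univ i, hi.2 ▸ inter_subset_left⟩
        calc _ ≤ (κ⁻¹ ^ #S * Fintype.card ι) * (p ^ #S)⁻¹ := by
              gcongr; exact hcard.trans (hspread S)
          _ = _ := by rw [mul_inv, mul_pow, inv_pow p, one_pow]; ring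
    _ = _ := by
        rw [← sum_mul, ← sum_pow_mul_eq_add_pow, ← add_sum_erase _ _ (empty_mem_powerset (H j))]
        simp

open scoped Classical in
/-- For an `r`-bounded `κ`-spread hypergraph on a finite set `Y`, with `t = α|Y|` an integer
and `ακ ≥ 2r`, a uniformly random `t`-element subset `W` of `Y` fails to contain an edge
with probability at most `2 exp[-ακ/(2r)]`. -/
theorem stmt9 {Y ι : Type*} [Fintype Y] [DecidableEq Y] [Fintype ι] [Nonempty ι]
    (H : ι → Finset Y) (r : ℕ) (κ : ℝ) (hκ : 0 < κ)
    (α : ℝ) (hα0 : 0 < α) (hα1 : α ≤ 1)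
    (t : ℕ) (ht : (t : ℝ) = α * Fintype.card Y)
    (hak : 2 * (r : ℝ) ≤ α * κ)
    (hbdd : ∀ j, (H j).card ≤ r)
    (hspread : ∀ S : Finset Y,
      ((Finset.univ.filter (fun j : ι => S ⊆ H j)).card : ℝ) ≤ κ⁻¹ ^ S.card * Fintype.card ι) :
    (((Finset.univ.powersetCard t).filter
        (fun T : Finset Y => ∀ j : ι, ¬ H j ⊆ T)).card : ℝ)
        / ((Fintype.card Y).choose t)
      ≤ 2 * Real.exp (-(α * κ) / (2 * r)) := by
  rcases Nat.eq_zero_or_pos r with rfl | hr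
  · have hempty : ∀ j, H j = ∅ := fun j => card_eq_zero.1 (Nat.le_zero.1 (hbdd j))
    simp [hempty]
  have hr0 : (0 : ℝ) < r := by exact_mod_cast hr
  have hακ : 0 < α * κ := mul_pos hα0 hκ
  set 𝒜 : Finset (Finset Y) := {T | ∀ j, ¬ H j ⊆ T} with h𝒜
  have hlower : IsLowerSet (𝒜 : Set (Finset Y)) := by
    intro S T hTS hS
    simp only [h𝒜, coe_filter, mem_univ, true_and, Set.mem_ofPred_eq] at hS ⊢
    exact fun j hj => hS j (hj.trans hTS)
  have hslice : (univ.powersetCard t).filter (fun T : Finset Y => ∀ j : ι, ¬ H j ⊆ T)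
      = 𝒜.slice t := by
    ext T
    simp [h𝒜, mem_slice, and_comm]
  rw [hslice]
  refine (card_slice_div_choose_le hlower hα0 hα1 ht).trans ?_
  gcongr
  have hD : ∀ j, ∑ i with ¬ Disjoint (H i) (H j), (α ^ #(H i ∩ H j))⁻¹
      ≤ 2 * r / (α * κ) * Fintype.card ι := by
    intro j
    have hx : |r * (α * κ)⁻¹| ≤ 1 := by
      rw [abs_of_nonneg (by positivity), ← div_eq_mul_inv, div_le_one hακ]
      linarith
    calc _ ≤ (((α * κ)⁻¹ + 1) ^ #(H j) - 1) * Fintype.card ι := by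
          convert sum_inv_pow_card_inter_le hα0 (fun S => ?_) j
          convert hspread S
      _ ≤ (Real.exp (r * (α * κ)⁻¹) - 1) * Fintype.card ι := by
          gcongr
          calc ((α * κ)⁻¹ + 1) ^ #(H j) ≤ ((α * κ)⁻¹ + 1) ^ r :=
                pow_le_pow_right₀ (by linarith [inv_pos.2 hακ]) (hbdd j)
            _ ≤ Real.exp (α * κ)⁻¹ ^ r := by gcongr; exact Real.add_one_le_exp _
            _ = _ := (Real.exp_nat_mul _ _).symm
      _ ≤ (2 * |r * (α * κ)⁻¹|) * Fintype.card ι := by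
          gcongr
          exact (le_abs_self _).trans (Real.abs_exp_sub_one_le hx)
      _ = _ := by rw [abs_of_nonneg (by positivity)]; ring
  have h := janson_inequality hα0 hα1 (by positivity) hD
  rw [inv_div, ← neg_div] at h
  convert h
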